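/- Let α, β, γ be complex numbers such that α is not a nonpositive integer, β−γ is not a nonpositive integer, and β−γ ≠ 0. Then for every complex x, γ · ₁F₁(1−γ; α; x) − β · ₁F₁(−γ; α; x) = (γ−β) · ₂F₂(−γ, β−γ+1; α, β−γ; x). -/

import Mathlib

/-- Pochhammer symbol `(a)_k` for complex `a`. -/
noncomputable def pochC (a : ℂ) (k : ℕ) : ℂ := (ascPochhammer ℂ k).eval a

/-- Confluent hypergeometric series `₁F₁(a; b; x)`. -/
noncomputable def hyp1F1 (a b x : ℂ) : ℂ :=
  ∑' k : ℕ, pochC a k * x ^ k / (pochC b k * (Nat.factorial k : ℂ))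

/-- Hypergeometric series `₂F₂(a, b; c, d; x)`. -/
noncomputable def hyp2F2 (a b c d x : ℂ) : ℂ :=
  ∑' k : ℕ, pochC a k * pochC b k * x ^ k / (pochC c k * pochC d k * (Nat.factorial k : ℂ))


lemma pochC_succ (a : ℂ) (k : ℕ) : pochC a (k + 1) = pochC a k * (a + k) := by
  simp [pochC, ascPochhammer_succ_eval]

lemma pochC_shift (a : ℂ) (k : ℕ) : a * pochC (a + 1) k = pochC a k * (a + k) := by
  rw [← pochC_succ]
  simp [pochC, ascPochhammer_succ_left, Polynomial.eval_comp]

lemma pochC_ne (b : ℂ) (hb : ∀ k : ℕ, b ≠ -(k : ℂ)) (k : ℕ) : pochC b k ≠ 0 := by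
  induction k with
  | zero => simp [pochC]
  | succ k ih =>
    rw [pochC_succ]
    exact mul_ne_zero ih fun h => hb k (eq_neg_of_add_eq_zero_left h)

lemma tendsto_inv_shift (c : ℂ) :
    Filter.Tendsto (fun k : ℕ => (c + (k : ℂ))⁻¹) Filter.atTop (nhds 0) := by
  apply Filter.tendsto_inv₀_cobounded.comp
  rw [← tendsto_norm_atTop_iff_cobounded]
  refine Filter.tendsto_atTop_mono (f := fun k : ℕ => -‖c‖ + (k : ℝ)) (fun k => ?_)
    (Filter.tendsto_atTop_add_const_left _ _ tendsto_natCast_atTop_atTop)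
  have h := norm_sub_le (c + (k : ℂ)) c
  simp only [add_sub_cancel_left, Complex.norm_natCast] at h
  linarith

lemma summable_1F1 (a b x : ℂ) (hb : ∀ k : ℕ, b ≠ -(k : ℂ)) :
    Summable fun k : ℕ => pochC a k * x ^ k / (pochC b k * (Nat.factorial k : ℂ)) := by
  have hbk : ∀ k : ℕ, b + k ≠ 0 := fun k h => hb k (eq_neg_of_add_eq_zero_left h)
  have h0 : Filter.Tendsto
      (fun k : ℕ => (1 + (a - b) * (b + (k : ℂ))⁻¹) * (x * (1 + (k : ℂ))⁻¹))
      Filter.atTop (nhds 0) := by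
    simpa using (((tendsto_inv_shift b).const_mul (a - b)).const_add 1).mul
      ((tendsto_inv_shift 1).const_mul x)
  have h1 := h0.norm
  rw [norm_zero] at h1
  refine summable_of_ratio_norm_eventually_le (r := 1 / 2) (by norm_num) ?_
  filter_upwards [h1.eventually_le_const (show (0 : ℝ) < 1 / 2 by norm_num)] with k hk
  refine le_trans (le_of_eq ?_) (mul_le_mul_of_nonneg_right hk (norm_nonneg _))
  rw [← norm_mul]
  congr 1
  have h2 := pochC_ne b hb k
  have h3 := hbk k
  have h4 : (Nat.factorial k : ℂ) ≠ 0 := by exact_mod_cast Nat.factorial_ne_zero k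
  have h5 : (1 + (k : ℂ)) ≠ 0 := by rw [add_comm]; exact Nat.cast_add_one_ne_zero k
  have h6 : ((k : ℂ) + 1) ≠ 0 := Nat.cast_add_one_ne_zero k
  rw [pochC_succ, pochC_succ, Nat.factorial_succ]
  push_cast
  field_simp
  ring

theorem stmt3 (α β γ : ℂ)
    (hα : ∀ k : ℕ, α ≠ -(k : ℂ))
    (hβγ : ∀ k : ℕ, β - γ ≠ -(k : ℂ))
    (hβγ0 : β - γ ≠ 0) :
    ∀ x : ℂ,
      γ * hyp1F1 (1 - γ) α x - β * hyp1F1 (-γ) α x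
        = (γ - β) * hyp2F2 (-γ) (β - γ + 1) α (β - γ) x := by
  intro x
  unfold hyp1F1 hyp2F2
  rw [← tsum_mul_left, ← tsum_mul_left, ← tsum_mul_left,
    ← ((summable_1F1 (1 - γ) α x hα).mul_left γ).tsum_sub
      ((summable_1F1 (-γ) α x hα).mul_left β)]
  congr 1
  funext k
  have h1 := pochC_shift (-γ) k
  have h2 := pochC_shift (β - γ) k
  rw [show -γ + 1 = 1 - γ by ring] at h1
  have h3 := pochC_ne _ hα k
  have h4 := pochC_ne _ hβγ k
  have h5 : (Nat.factorial k : ℂ) ≠ 0 := by exact_mod_cast Nat.factorial_ne_zero k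
  field_simp
  linear_combination (-(pochC (β - γ) k) * x ^ k) * h1 + (pochC (-γ) k * x ^ k) * h2
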